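/- Let A ∈ ℂ^{n×m} and X ∈ ℂ^{m×N} with X ≠ 0 and N ≥ 2. Then rank M(A,X) = rank D(A,X) + 1. In particular, M(A,X) has full column rank mN if and only if rank D(A,X) = mN − 1. -/

import Mathlib

open MeasureTheory Matrix

noncomputable section

/-- The `(N-1) × N` matrix `B(a,X)`: for `j = 0,…,N-2` (0-indexed), entry `(j,0)` is
`-(a · X^{(:,j+1)})`, entry `(j,j+1)` is `a · X^{(:,0)}`, all other entries zero. -/
def Bmat {m N : ℕ} (a : Fin m → ℂ) (X : Matrix (Fin m) (Fin N) ℂ) :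
    Matrix (Fin (N - 1)) (Fin N) ℂ :=
  Matrix.of fun j k =>
    if (k : ℕ) = 0 then
      -(a ⬝ᵥ fun i => X i ⟨(j : ℕ) + 1, by have := j.isLt; omega⟩)
    else if (k : ℕ) = (j : ℕ) + 1 then
      a ⬝ᵥ fun i => X i ⟨0, by have := j.isLt; omega⟩
    else 0

/-- Column-wise vectorization of `X`, indexed by (column, row). -/
def vecM {m N : ℕ} (X : Matrix (Fin m) (Fin N) ℂ) : Fin N × Fin m → ℂ :=
  fun p => X p.2 p.1

/-- `D(a,X) = B(a,X) ⊗ a`, an `(N-1) × mN` matrix, columns indexed compatibly with `vecM`. -/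
def Dsmall {m N : ℕ} (a : Fin m → ℂ) (X : Matrix (Fin m) (Fin N) ℂ) :
    Matrix (Fin (N - 1)) (Fin N × Fin m) ℂ :=
  Matrix.of fun j p => Bmat a X j p.1 * a p.2

/-- `D(A,X)`: vertical stack of `D(A^{(k,:)},X)` over the rows `k` of `A`. -/
def Dbig {n m N : ℕ} (A : Matrix (Fin n) (Fin m) ℂ) (X : Matrix (Fin m) (Fin N) ℂ) :
    Matrix (Fin n × Fin (N - 1)) (Fin N × Fin m) ℂ :=
  Matrix.of fun q p => Dsmall (A q.1) X q.2 p

/-- `M(A,X)`: the row `vec(X)^*` stacked on top of `D(A,X)`. -/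
def Mmat {n m N : ℕ} (A : Matrix (Fin n) (Fin m) ℂ) (X : Matrix (Fin m) (Fin N) ℂ) :
    Matrix (Unit ⊕ Fin n × Fin (N - 1)) (Fin N × Fin m) ℂ :=
  Matrix.of fun q p =>
    match q with
    | Sum.inl _ => star (vecM X p)
    | Sum.inr r => Dbig A X r p

theorem Bmat_mulVec {m N : ℕ} (a : Fin m → ℂ) (X : Matrix (Fin m) (Fin N) ℂ) :
    Bmat a X *ᵥ (a ᵥ* X) = 0 := by
  ext j
  have hj : (j : ℕ) + 1 < N := by omega
  have h0 : 0 < N := by omega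
  have hB : ∀ k : Fin N, Bmat a X j k =
      (if k = ⟨0, h0⟩ then -((a ᵥ* X) ⟨(j : ℕ) + 1, hj⟩) else 0) +
        if k = ⟨(j : ℕ) + 1, hj⟩ then (a ᵥ* X) ⟨0, h0⟩ else 0 := by
    intro k
    simp only [Bmat, Matrix.of_apply, Fin.ext_iff]
    by_cases hk : (k : ℕ) = 0
    · simp [hk, vecMul]
    · simp [hk, vecMul]
  simp only [mulVec, dotProduct, hB, add_mul, ite_mul, zero_mul, Finset.sum_add_distrib,
    Finset.sum_ite_eq', Finset.mem_univ, if_true, Pi.zero_apply]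
  ring

theorem Dbig_mulVec_vecM {n m N : ℕ} (A : Matrix (Fin n) (Fin m) ℂ)
    (X : Matrix (Fin m) (Fin N) ℂ) : Dbig A X *ᵥ vecM X = 0 := by
  ext ⟨r, j⟩
  have h := congrFun (Bmat_mulVec (A r) X) j
  refine Eq.trans ?_ h
  simp only [mulVec, dotProduct, Dbig, Dsmall, vecM, vecMul, Matrix.of_apply,
    Fintype.sum_prod_type, Finset.mul_sum, mul_assoc]

/-- Adjoining to the rows of `D` the conjugate of a nonzero kernel vector raises the dimension of
their span by one. -/
theorem finrank_span_insert_star_row {r c : Type*} [Finite r] [Fintype c]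
    (D : Matrix r c ℂ) {v : c → ℂ} (hv : v ≠ 0) (hD : D *ᵥ v = 0) :
    Module.finrank ℂ (Submodule.span ℂ (insert (star v) (Set.range D.row))) = D.rank + 1 := by
  have orth : ∀ w ∈ Submodule.span ℂ (Set.range D.row), w ⬝ᵥ v = 0 := by
    intro w hw
    induction hw using Submodule.span_induction with
    | mem w hw =>
      obtain ⟨i, rfl⟩ := hw
      exact congrFun hD i
    | zero => exact zero_dotProduct v
    | add x y _ _ hx hy => rw [add_dotProduct, hx, hy, add_zero]
    | smul a x _ hx => rw [smul_dotProduct, hx, smul_zero]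
  have hmem : star v ∉ Submodule.span ℂ (Set.range D.row) := by
    intro h
    open scoped ComplexOrder in
    exact hv (dotProduct_star_self_eq_zero.mp (orth _ h))
  rw [Submodule.span_insert, sup_comm, Submodule.finrank_sup_span_singleton hmem,
    rank_eq_finrank_span_row]

theorem range_row_Mmat {n m N : ℕ} (A : Matrix (Fin n) (Fin m) ℂ)
    (X : Matrix (Fin m) (Fin N) ℂ) :
    Set.range (Mmat A X).row = insert (star (vecM X)) (Set.range (Dbig A X).row) := by
  ext w
  simp only [Set.mem_range, Sum.exists, Set.mem_insert_iff, eq_comm (a := w),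
    Unique.exists_iff]
  rfl

/-- For `X ≠ 0` and `N ≥ 2`: `rank M(A,X) = rank D(A,X) + 1`; in particular `M(A,X)` has full
column rank `mN` iff `rank D(A,X) = mN - 1`. -/
theorem stmt12 {n m N : ℕ} (hN : 2 ≤ N)
    (A : Matrix (Fin n) (Fin m) ℂ) (X : Matrix (Fin m) (Fin N) ℂ) (hX : X ≠ 0) :
    (Mmat A X).rank = (Dbig A X).rank + 1 ∧
      ((Mmat A X).rank = m * N ↔ (Dbig A X).rank = m * N - 1) := by
  have hv : vecM X ≠ 0 := fun h => hX (by
    ext i j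
    exact congrFun h (j, i))
  have hrank : (Mmat A X).rank = (Dbig A X).rank + 1 := by
    rw [rank_eq_finrank_span_row, range_row_Mmat,
      finrank_span_insert_star_row _ hv (Dbig_mulVec_vecM A X)]
  have hm : 0 < m := Nat.pos_of_ne_zero (by
    rintro rfl
    exact hX (Subsingleton.elim _ _))
  have hmN : 0 < m * N := Nat.mul_pos hm (by omega)
  exact ⟨hrank, by omega⟩
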